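/- With notation as in the previous statement, if f has Fourier transform supported in B(0,R), then for every δ > 0 and every L ∈ G(d,k), M^k_δ[|f|](L) ≤ C · M^k_{1/R}[|f|](L), with C depending only on d, k, φ. -/

import Mathlib

open MeasureTheory Set Metric ENNReal

noncomputable section

abbrev Ed (d : ℕ) := EuclideanSpace ℝ (Fin d)

instance (d : ℕ) : MeasurableSpace (Submodule ℝ (Ed d)) := ⊤

/-- `γ` is the invariant probability measure on the Grassmannian `G(d,k)`. -/
def IsGrassmannianMeasure (d k : ℕ) (γ : Measure (Submodule ℝ (Ed d))) : Prop :=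
  IsProbabilityMeasure γ ∧
    (∀ θ : Ed d ≃ₗᵢ[ℝ] Ed d,
      Measure.map (fun L => Submodule.map (θ.toLinearEquiv : Ed d →ₗ[ℝ] Ed d) L) γ = γ) ∧
    γ {L | Module.finrank ℝ L = k}ᶜ = 0

/-- The `δ`-plate `L_δ(a)`: the `δ`-neighborhood of `(L + a) ∩ B(a, 1/2)`. -/
def plate (d : ℕ) (L : Submodule ℝ (Ed d)) (δ : ℝ) (a : Ed d) : Set (Ed d) :=
  Metric.thickening δ ({x | x - a ∈ L} ∩ Metric.closedBall a (1 / 2))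

/-- The plate-average maximal operator `M^k_δ`. -/
def maxOp (d : ℕ) (δ : ℝ) (f : Ed d → ℝ≥0∞) (L : Submodule ℝ (Ed d)) : ℝ≥0∞ :=
  ⨆ a : Ed d, (volume (plate d L δ a))⁻¹ * ∫⁻ x in plate d L δ a, f x

section Fourier

open FourierTransform SchwartzMap

theorem ae_eq_zero_of_fourier_eq_zero {d : ℕ} {h : Ed d → ℂ} (hh : Integrable h)
    (h0 : ∀ ξ, 𝓕 h ξ = 0) : ∀ᵐ x, h x = 0 := by
  refine ae_eq_zero_of_integral_contDiff_smul_eq_zero hh.locallyIntegrable fun g hg hgc => ?_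
  have hg₁ : HasCompactSupport (Complex.ofRealCLM ∘ g) := hgc.comp_left rfl
  have hg₂ : ContDiff ℝ ((⊤ : ℕ∞) : WithTop ℕ∞) (Complex.ofRealCLM ∘ g) := by fun_prop
  set ψ : 𝓢(Ed d, ℂ) := hg₁.toSchwartzMap hg₂
  set χ : 𝓢(Ed d, ℂ) := 𝓕⁻ ψ with hχ
  have key : ∫ ξ, 𝓕 h ξ * χ ξ = ∫ x, h x * 𝓕 (⇑χ) x := by
    simpa using! VectorFourier.integral_bilin_fourierIntegral_eq_flip (.mul ℂ ℂ)
      (L := innerₗ (Ed d)) Real.continuous_fourierChar continuous_inner hh χ.integrable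
  rw [← SchwartzMap.fourier_coe, hχ, FourierTransform.fourier_fourierInv_eq] at key
  simp only [h0, zero_mul, integral_zero] at key
  rw [key]
  refine integral_congr_ae (.of_forall fun x => ?_)
  simp [ψ, mul_comm]

theorem exists_schwartz_fourier_eq_one (d : ℕ) :
    ∃ φ : 𝓢(Ed d, ℂ), ∀ ξ ∈ closedBall (0 : Ed d) 1, 𝓕 (⇑φ) ξ = 1 := by
  let b : ContDiffBump (0 : Ed d) := ⟨1, 2, one_pos, one_lt_two⟩
  have hb₁ : HasCompactSupport (Complex.ofRealCLM ∘ b) := b.hasCompactSupport.comp_left rfl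
  have hb₂ : ContDiff ℝ ((⊤ : ℕ∞) : WithTop ℕ∞) (Complex.ofRealCLM ∘ b) :=
    Complex.ofRealCLM.contDiff.comp b.contDiff
  refine ⟨𝓕⁻ (hb₁.toSchwartzMap hb₂), fun ξ hξ => ?_⟩
  rw [← SchwartzMap.fourier_coe, FourierTransform.fourier_fourierInv_eq]
  simpa using b.one_of_mem_closedBall hξ

open Convolution in
theorem ae_eq_convolution_of_fourier_support_subset {d : ℕ} {φ f : Ed d → ℂ}
    (hφ : Integrable φ) (hφ1 : ∀ ξ ∈ closedBall (0 : Ed d) 1, 𝓕 φ ξ = 1) (hf : Integrable f)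
    (hs : Function.support (𝓕 f) ⊆ closedBall 0 1) :
    ∀ᵐ x, f x = ∫ y, φ y * f (x - y) := by
  have hc : Integrable (φ ⋆[ContinuousLinearMap.mul ℂ ℂ] f) := hφ.integrable_convolution _ hf
  have := ae_eq_zero_of_fourier_eq_zero (hf.sub hc) fun ξ => by
    have h1 : 𝓕 (f - φ ⋆[ContinuousLinearMap.mul ℂ ℂ] f) ξ
        = 𝓕 f ξ - 𝓕 (φ ⋆[ContinuousLinearMap.mul ℂ ℂ] f) ξ := by
      simp only [Real.fourier_eq, Pi.sub_apply, smul_sub]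
      exact integral_sub ((Real.fourierIntegral_convergent_iff ξ).2 hf)
        ((Real.fourierIntegral_convergent_iff ξ).2 hc)
    rw [h1, Real.fourier_mul_convolution_eq hφ hf]
    by_cases hξ : ξ ∈ closedBall (0 : Ed d) 1
    · simp [hφ1 ξ hξ]
    · simp [Function.notMem_support.1 fun h => hξ (hs h)]
  filter_upwards [this] with x hx
  exact sub_eq_zero.1 hx

theorem support_fourier_comp_smul_subset {d : ℕ} {f : Ed d → ℂ} {R : ℝ} (hR : 0 < R)
    (hs : Function.support (𝓕 f) ⊆ closedBall 0 R) :
    Function.support (𝓕 fun x => f (R⁻¹ • x)) ⊆ closedBall 0 1 := by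
  intro ξ hξ
  have h : 𝓕 (fun x => f (R⁻¹ • x)) ξ = (R ^ d : ℝ) • 𝓕 f (R • ξ) := by
    have := Measure.integral_comp_smul (volume : Measure (Ed d))
      (fun x => Real.fourierChar (-inner ℝ x (R • ξ)) • f x) R⁻¹
    simp only [finrank_euclideanSpace, Fintype.card_fin, inv_pow, inv_inv] at this
    rw [abs_of_pos (by positivity)] at this
    rw [Real.fourier_eq, Real.fourier_eq, ← this]
    simp [inner_smul_left, inner_smul_right, hR.ne']
  have h' : R • ξ ∈ closedBall (0 : Ed d) R := hs fun h0 => hξ (by rw [h, h0, smul_zero])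
  rw [mem_closedBall_zero_iff, norm_smul, Real.norm_of_nonneg hR.le] at h'
  rw [mem_closedBall_zero_iff]
  exact le_of_mul_le_mul_left (by simpa using h') hR

theorem ae_enorm_le_lintegral_of_fourier_support_subset {d : ℕ} {φ f : Ed d → ℂ}
    (hφ : Integrable φ) (hφ1 : ∀ ξ ∈ closedBall (0 : Ed d) 1, 𝓕 φ ξ = 1) (hf : Integrable f)
    {R : ℝ} (hR : 0 < R) (hs : Function.support (𝓕 f) ⊆ closedBall 0 R) :
    ∀ᵐ x, ‖f x‖ₑ ≤ ∫⁻ y, ‖φ y‖ₑ * ‖f (x - R⁻¹ • y)‖ₑ := by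
  have hF : Integrable (fun x => f (R⁻¹ • x)) := hf.comp_smul (inv_ne_zero hR.ne')
  have h := ae_eq_convolution_of_fourier_support_subset hφ hφ1 hF
    (support_fourier_comp_smul_subset hR hs)
  have hq : Measure.QuasiMeasurePreserving (fun x : Ed d => R • x) volume volume :=
    Measure.quasiMeasurePreserving_smul _ hR.ne'
  filter_upwards [hq.ae h] with x hx
  rw [inv_smul_smul₀ hR.ne'] at hx
  simp only [smul_sub, inv_smul_smul₀ hR.ne'] at hx
  rw [hx]
  refine (enorm_integral_le_lintegral_enorm _).trans_eq ?_
  simp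

theorem SchwartzMap.exists_enorm_le_one_add_norm_pow {d : ℕ} (φ : 𝓢(Ed d, ℂ)) (N : ℕ) :
    ∃ C : ℝ, 0 < C ∧ ∀ y, ‖φ y‖ₑ ≤ ENNReal.ofReal C * ENNReal.ofReal (((1 + ‖y‖) ^ N)⁻¹) := by
  set C := 2 ^ N * (Finset.Iic (N, 0)).sup (fun m => SchwartzMap.seminorm ℝ m.1 m.2) φ
  have hC : 0 ≤ C := by positivity
  refine ⟨C + 1, by positivity, fun y => ?_⟩
  have h := SchwartzMap.one_add_le_sup_seminorm_apply (𝕜 := ℝ) (m := (N, 0)) le_rfl le_rfl φ y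
  rw [norm_iteratedFDeriv_zero] at h
  rw [← ENNReal.ofReal_mul (by positivity), ← ofReal_norm]
  refine ENNReal.ofReal_le_ofReal ?_
  rw [← div_eq_mul_inv, le_div_iff₀ (by positivity), mul_comm]
  change _ ≤ C at h
  linarith

end Fourier

section Plates

variable {d : ℕ} {L : Submodule ℝ (Ed d)} {δ r : ℝ}

theorem mem_plate_iff {a x : Ed d} :
    x ∈ plate d L δ a ↔ ∃ l ∈ L, ‖l‖ ≤ 1 / 2 ∧ ‖x - a - l‖ < δ := by
  simp only [plate, mem_thickening_iff, mem_inter_iff, mem_ofPred_eq, mem_closedBall,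
    dist_eq_norm]
  constructor
  · rintro ⟨z, ⟨hz, hz'⟩, h⟩
    exact ⟨z - a, hz, hz', by simpa using h⟩
  · rintro ⟨l, hl, hl', h⟩
    exact ⟨a + l, ⟨by simpa using hl, by simpa using hl'⟩, by simpa [sub_sub] using h⟩

theorem mem_plate_iff_sub_mem {a x : Ed d} : x ∈ plate d L δ a ↔ x - a ∈ plate d L δ 0 := by
  simp [mem_plate_iff]

theorem plate_mono (h : r ≤ δ) (a : Ed d) : plate d L r a ⊆ plate d L δ a :=
  thickening_mono h _

theorem neg_mem_plate_zero {x : Ed d} (h : x ∈ plate d L δ 0) : -x ∈ plate d L δ 0 := by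
  obtain ⟨l, hl, hl', h⟩ := mem_plate_iff.1 h
  refine mem_plate_iff.2 ⟨-l, L.neg_mem hl, by simpa using hl', ?_⟩
  rwa [← norm_neg, show -(-x - 0 - -l) = x - 0 - l by abel]

theorem convex_plate_zero : Convex ℝ (plate d L δ 0) := by
  refine Convex.thickening (Convex.inter ?_ (convex_closedBall _ _)) δ
  simpa using L.convex

theorem isOpen_plate {a : Ed d} : IsOpen (plate d L δ a) := isOpen_thickening

theorem norm_sub_lt_of_mem_plate {a x : Ed d} (h : x ∈ plate d L δ a) : ‖x - a‖ < 1 / 2 + δ := by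
  obtain ⟨l, -, hl, h⟩ := mem_plate_iff.1 h
  have := norm_add_le l (x - a - l)
  rw [add_sub_cancel] at this
  linarith

theorem volume_plate (a : Ed d) : volume (plate d L δ a) = volume (plate d L δ 0) := by
  rw [← measure_preimage_add_right volume (-a) (plate d L δ 0)]
  congr 1
  ext x
  rw [mem_plate_iff_sub_mem, mem_preimage, sub_eq_add_neg]

theorem volume_plate_ne_zero (hδ : 0 < δ) (a : Ed d) : volume (plate d L δ a) ≠ 0 :=
  (isOpen_plate.measure_pos _ ⟨a, mem_plate_iff.2 ⟨0, L.zero_mem, by simp, by simpa⟩⟩).ne'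

theorem volume_plate_ne_top (a : Ed d) : volume (plate d L δ a) ≠ ∞ := by
  refine ((measure_mono fun x hx => ?_).trans_lt
    (measure_ball_lt_top (μ := volume) (x := a) (r := 1 / 2 + δ))).ne
  rw [mem_ball, dist_eq_norm]
  exact norm_sub_lt_of_mem_plate hx

theorem setLIntegral_plate_le (hr : 0 < r) (u : Ed d → ℝ≥0∞) (a : Ed d) :
    ∫⁻ x in plate d L r a, u x ≤ volume (plate d L r 0) * maxOp d r u L := by
  rw [← ENNReal.inv_mul_le_iff (volume_plate_ne_zero hr 0) (volume_plate_ne_top 0),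
    ← volume_plate a]
  exact le_iSup (fun a => (volume (plate d L r a))⁻¹ * ∫⁻ x in plate d L r a, u x) a

theorem maxOp_le_of_setLIntegral_le (hδ : 0 < δ) {u : Ed d → ℝ≥0∞} {M : ℝ≥0∞}
    (h : ∀ a, ∫⁻ x in plate d L δ a, u x ≤ volume (plate d L δ 0) * M) : maxOp d δ u L ≤ M := by
  refine iSup_le fun a => ?_
  rw [ENNReal.inv_mul_le_iff (volume_plate_ne_zero hδ a) (volume_plate_ne_top a), volume_plate]
  exact h a

theorem maxOp_congr_ae {u v : Ed d → ℝ≥0∞} (h : u =ᵐ[volume] v) :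
    maxOp d δ u L = maxOp d δ v L := by
  simp only [maxOp, lintegral_congr_ae (ae_restrict_of_ae h)]

theorem maxOp_mono_ae {u v : Ed d → ℝ≥0∞} (h : u ≤ᵐ[volume] v) :
    maxOp d δ u L ≤ maxOp d δ v L :=
  iSup_mono fun _ => mul_le_mul_right (lintegral_mono_ae (ae_restrict_of_ae h)) _

theorem maxOp_const_mul {u : Ed d → ℝ≥0∞} (hu : Measurable u) (c : ℝ≥0∞) :
    maxOp d δ (fun x => c * u x) L = c * maxOp d δ u L := by
  simp only [maxOp, ENNReal.mul_iSup, lintegral_const_mul c hu, mul_left_comm]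

/-- Averaging over translates: if `A + P ⊆ B`, where `P` is the centred `r`-plate, then the
integral of `u` over `A` is controlled by the plate averages of `u`. -/
theorem setLIntegral_le_volume_mul_maxOp (hr : 0 < r) {u : Ed d → ℝ≥0∞} (hu : Measurable u)
    {A B : Set (Ed d)} (hA : MeasurableSet A) (hB : MeasurableSet B)
    (hAB : ∀ x ∈ A, ∀ p ∈ plate d L r 0, x + p ∈ B) :
    ∫⁻ x in A, u x ≤ volume B * maxOp d r u L := by
  set P := plate d L r 0
  have hP : MeasurableSet P := isOpen_plate.measurableSet
  have h1 : volume P * ∫⁻ x in A, u x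
      = ∫⁻ x, ∫⁻ z, A.indicator u x * P.indicator 1 (x - z) := by
    rw [← lintegral_indicator hA, ← lintegral_const_mul _ (hu.indicator hA)]
    refine lintegral_congr fun x => ?_
    rw [lintegral_const_mul _ (by fun_prop (disch := assumption)),
      lintegral_sub_left_eq_self (fun y => P.indicator 1 y) x, lintegral_indicator_one hP, mul_comm]
  have h2 : ∀ z, ∫⁻ x, A.indicator u x * P.indicator 1 (x - z)
      ≤ B.indicator (fun _ => volume P * maxOp d r u L) z := by
    intro z
    by_cases hz : z ∈ B
    · rw [indicator_of_mem hz]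
      refine le_trans ?_ (setLIntegral_plate_le hr u z)
      rw [← lintegral_indicator isOpen_plate.measurableSet]
      refine lintegral_mono fun x => ?_
      by_cases hx : x - z ∈ P
      · rw [indicator_of_mem hx, indicator_of_mem (mem_plate_iff_sub_mem.2 hx)]
        simpa using indicator_le_self A u x
      · simp [hx]
    · refine (lintegral_eq_zero_of_ae_eq_zero (.of_forall fun x => ?_)).trans_le zero_le
      by_cases hx : x ∈ A
      · have : x - z ∉ P := fun h => hz (by simpa using hAB x hx _ (neg_mem_plate_zero h))
        simp [this]
      · simp [hx]
  have h3 : volume P * ∫⁻ x in A, u x ≤ volume P * (volume B * maxOp d r u L) := by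
    rw [h1, lintegral_lintegral_swap]
    · refine (lintegral_mono h2).trans_eq ?_
      rw [lintegral_indicator_const hB]
      ring
    · exact (((hu.indicator hA).comp measurable_fst).mul
        ((measurable_one.indicator hP).comp (measurable_fst.sub measurable_snd))).aemeasurable
  exact (ENNReal.mul_le_mul_iff_right (volume_plate_ne_zero hr 0) (volume_plate_ne_top 0)).1 h3

theorem volume_dilate_plate {c : ℝ} (hc : 0 < c) (a : Ed d) :
    volume {x | c⁻¹ • (x - a) ∈ plate d L δ 0}
      = ENNReal.ofReal (c ^ d) * volume (plate d L δ 0) := by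
  have : {x | c⁻¹ • (x - a) ∈ plate d L δ 0}
      = (fun x => x + -a) ⁻¹' ((c⁻¹ • ·) ⁻¹' plate d L δ 0) := by
    ext x
    simp [sub_eq_add_neg]
  rw [this, measure_preimage_add_right, Measure.addHaar_preimage_smul _ (inv_ne_zero hc.ne')]
  simp [abs_of_pos hc]

theorem measurableSet_dilate_plate {c : ℝ} (a : Ed d) :
    MeasurableSet {x | c⁻¹ • (x - a) ∈ plate d L δ 0} :=
  isOpen_plate.measurableSet.preimage (by fun_prop)

theorem maxOp_le_of_le (hr : 0 < r) (h : r ≤ δ) {u : Ed d → ℝ≥0∞} (hu : Measurable u) :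
    maxOp d δ u L ≤ ENNReal.ofReal (2 ^ d) * maxOp d r u L := by
  refine maxOp_le_of_setLIntegral_le (hr.trans_le h) fun a => ?_
  refine (setLIntegral_le_volume_mul_maxOp (L := L) hr hu isOpen_plate.measurableSet
    (measurableSet_dilate_plate (δ := δ) (L := L) (c := 2) a) fun x hx p hp => ?_).trans_eq ?_
  · have := convex_plate_zero (mem_plate_iff_sub_mem.1 hx) (plate_mono h 0 hp)
      (a := 2⁻¹) (b := 2⁻¹) (by norm_num) (by norm_num) (by norm_num)
    rwa [← smul_add, ← add_sub_right_comm] at this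
  · rw [volume_dilate_plate two_pos]
    ring

theorem setLIntegral_dilate_plate_le (hr : 0 < r) {u : Ed d → ℝ≥0∞} (hu : Measurable u) (a : Ed d) :
    ∫⁻ x in {x | (2 : ℝ)⁻¹ • (x - a) ∈ plate d L r 0}, u x
      ≤ ENNReal.ofReal (3 ^ d) * volume (plate d L r 0) * maxOp d r u L := by
  rw [← volume_dilate_plate three_pos a]
  refine setLIntegral_le_volume_mul_maxOp hr hu (measurableSet_dilate_plate a)
    (measurableSet_dilate_plate a) fun x hx p hp => ?_
  have := convex_plate_zero hx hp
    (a := 2 / 3) (b := 1 / 3) (by norm_num) (by norm_num) (by norm_num)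
  simp only [mem_ofPred_eq]
  convert this using 1
  module


/-- The involution of `E × E` exchanging the components orthogonal to `L`. -/
def swapOrthogonal (L : Submodule ℝ (Ed d)) : Ed d × Ed d →ₗ[ℝ] Ed d × Ed d :=
  let π : Ed d →ₗ[ℝ] Ed d := L.starProjection
  LinearMap.prod
    (π ∘ₗ LinearMap.fst ℝ _ _ + (LinearMap.id - π) ∘ₗ LinearMap.snd ℝ _ _)
    (π ∘ₗ LinearMap.snd ℝ _ _ + (LinearMap.id - π) ∘ₗ LinearMap.fst ℝ _ _)

theorem swapOrthogonal_apply (x y : Ed d) :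
    swapOrthogonal L (x, y) = (L.starProjection x + (y - L.starProjection y),
      L.starProjection y + (x - L.starProjection x)) := rfl

theorem swapOrthogonal_comp_self : swapOrthogonal L ∘ₗ swapOrthogonal L = LinearMap.id := by
  refine LinearMap.ext fun ⟨x, y⟩ => ?_
  have h : ∀ z, L.starProjection (L.starProjection z) = L.starProjection z := fun z =>
    Submodule.starProjection_eq_self_iff.2 (L.starProjection_apply_mem z)
  simp [swapOrthogonal_apply, h]

theorem measurePreserving_swapOrthogonal :
    MeasurePreserving (swapOrthogonal L) (volume.prod volume) (volume.prod volume) := by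
  have h : LinearMap.det (swapOrthogonal L) * LinearMap.det (swapOrthogonal L) = 1 := by
    rw [← LinearMap.det_comp, swapOrthogonal_comp_self, LinearMap.det_id]
  refine ⟨(LinearMap.continuous_of_finiteDimensional _).measurable, ?_⟩
  rw [Measure.map_linearMap_addHaar_eq_smul_addHaar _ (left_ne_zero_of_mul_eq_one h)]
  have : |(LinearMap.det (swapOrthogonal L))⁻¹| = 1 := by
    rcases mul_self_eq_one_iff.1 h with h | h <;> simp [h]
  simp [this]

theorem norm_sub_starProjection_le (e : Ed d) : ‖e - L.starProjection e‖ ≤ ‖e‖ := by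
  simpa using Lᗮ.norm_starProjection_apply_le e

theorem norm_starProjection_add_le (e n : Ed d) :
    ‖L.starProjection e + (n - L.starProjection n)‖ ≤ ‖e‖ + ‖n‖ :=
  (norm_add_le _ _).trans
    (add_le_add (L.norm_starProjection_apply_le e) (norm_sub_starProjection_le n))

theorem swapOrthogonal_mem {x y : Ed d} (hδr : δ ≤ r) (hr2 : r ≤ 1 / 2)
    (hx : x ∈ plate d L δ 0) (hy : y ∈ plate d L r 0) :
    (2 : ℝ)⁻¹ • (swapOrthogonal L (x, y)).1 ∈ plate d L r 0 ∧
      (2 : ℝ)⁻¹ • (swapOrthogonal L (x, y)).2 ∈ plate d L δ 0 ∧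
      ‖x - (swapOrthogonal L (x, y)).1‖ ≤ 2 * r := by
  obtain ⟨l, hl, hl', hx⟩ := mem_plate_iff.1 hx
  obtain ⟨m, hm, hm', hy⟩ := mem_plate_iff.1 hy
  rw [sub_zero] at hx hy
  have πl : L.starProjection l = l := Submodule.starProjection_eq_self_iff.2 hl
  have πm : L.starProjection m = m := Submodule.starProjection_eq_self_iff.2 hm
  obtain ⟨e, rfl⟩ : ∃ e, x = l + e := ⟨x - l, by abel⟩
  obtain ⟨n, rfl⟩ : ∃ n, y = m + n := ⟨y - m, by abel⟩
  rw [add_sub_cancel_left] at hx hy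
  have half : ‖(2 : ℝ)⁻¹‖ = 1 / 2 := by norm_num
  simp only [swapOrthogonal_apply, map_add, πl, πm]
  refine ⟨mem_plate_iff.2 ⟨(2 : ℝ)⁻¹ • l, L.smul_mem _ hl, ?_, ?_⟩,
    mem_plate_iff.2 ⟨(2 : ℝ)⁻¹ • (m + L.starProjection n),
      L.smul_mem _ (L.add_mem hm (L.starProjection_apply_mem n)), ?_, ?_⟩, ?_⟩
  · rw [norm_smul, half]
    linarith
  · rw [show (2 : ℝ)⁻¹ • (l + L.starProjection e + (m + n - (m + L.starProjection n))) - 0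
      - (2 : ℝ)⁻¹ • l = (2 : ℝ)⁻¹ • (L.starProjection e + (n - L.starProjection n)) by module,
      norm_smul, half]
    linarith [norm_starProjection_add_le (L := L) e n]
  · rw [norm_smul, half]
    linarith [norm_add_le m (L.starProjection n), L.norm_starProjection_apply_le n]
  · rw [show (2 : ℝ)⁻¹ • (m + L.starProjection n + (l + e - (l + L.starProjection e))) - 0
      - (2 : ℝ)⁻¹ • (m + L.starProjection n) = (2 : ℝ)⁻¹ • (e - L.starProjection e) by module,
      norm_smul, half]
    linarith [norm_sub_starProjection_le (L := L) e, norm_nonneg e]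
  · rw [show l + e - (l + L.starProjection e + (m + n - (m + L.starProjection n)))
      = (e - L.starProjection e) - (n - L.starProjection n) by abel]
    linarith [norm_sub_starProjection_le (L := L) e, norm_sub_starProjection_le (L := L) n,
      norm_sub_le (e - L.starProjection e) (n - L.starProjection n)]

theorem volume_mul_setLIntegral_le (hδr : δ ≤ r) (hr2 : r ≤ 1 / 2)
    {g : Ed d → ℝ≥0∞} (hg : Measurable g) {K : ℝ≥0∞}
    (hK : ∀ x x', ‖x - x'‖ ≤ 4 * r → g x ≤ K * g x') (a : Ed d) :
    volume (plate d L r 0) * ∫⁻ x in plate d L δ a, g x ≤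
      K * (ENNReal.ofReal (2 ^ d) * volume (plate d L δ 0)) *
        ∫⁻ x in {x | (2 : ℝ)⁻¹ • (x - a) ∈ plate d L r 0}, g x := by
  set P := plate d L δ 0
  set Q := plate d L r 0
  have hQ : MeasurableSet Q := isOpen_plate.measurableSet
  have hP2 := measurableSet_dilate_plate (L := L) (δ := δ) (c := 2) 0
  have hQ2 := measurableSet_dilate_plate (L := L) (δ := r) (c := 2) a
  set P2 := {x : Ed d | (2 : ℝ)⁻¹ • (x - 0) ∈ P}
  set Q2 := {x : Ed d | (2 : ℝ)⁻¹ • (x - a) ∈ Q}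
  have htr : ∀ {s : Set (Ed d)}, MeasurableSet s →
      ∫⁻ x in s, g x = ∫⁻ x, s.indicator g (x + a) := fun hs => by
    rw [← lintegral_indicator hs, lintegral_add_right_eq_self]
  have hprod : ∀ {s t : Set (Ed d)}, MeasurableSet s → MeasurableSet t →
      volume t * ∫⁻ x in s, g x = ∫⁻ p : Ed d × Ed d,
        s.indicator g (p.1 + a) * t.indicator 1 p.2 ∂(volume.prod volume) := by
    intro s t hs ht
    rw [lintegral_prod_mul (f := fun x => s.indicator g (x + a))
      ((hg.indicator hs).comp (measurable_add_const a)).aemeasurable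
      (measurable_one.indicator ht).aemeasurable, lintegral_indicator_one ht, htr hs, mul_comm]
  have hmeas : Measurable fun p : Ed d × Ed d => Q2.indicator g (p.1 + a) * P2.indicator 1 p.2 :=
    ((hg.indicator hQ2).comp (measurable_fst.add_const a)).mul
      ((measurable_one.indicator hP2).comp measurable_snd)
  have hmeas' : Measurable fun p : Ed d × Ed d => Q2.indicator g ((swapOrthogonal L p).1 + a) *
      P2.indicator 1 (swapOrthogonal L p).2 :=
    hmeas.comp (measurePreserving_swapOrthogonal (L := L)).measurable
  rw [← volume_dilate_plate two_pos 0, mul_assoc, hprod isOpen_plate.measurableSet hQ,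
    hprod hQ2 hP2, ← (measurePreserving_swapOrthogonal (L := L)).lintegral_comp hmeas,
    ← lintegral_const_mul _ hmeas']
  refine lintegral_mono fun ⟨x, y⟩ => ?_
  by_cases hx : x ∈ P
  · by_cases hy : y ∈ Q
    · obtain ⟨h1, h2, h3⟩ := swapOrthogonal_mem hδr hr2 hx hy
      have h1' : (swapOrthogonal L (x, y)).1 + a ∈ Q2 := by simpa [Q2] using h1
      have h2' : (swapOrthogonal L (x, y)).2 ∈ P2 := by simpa [P2] using h2
      simp only [indicator_of_mem hy, indicator_of_mem h1', indicator_of_mem h2', Pi.one_apply,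
        mul_one]
      refine (indicator_le_self _ _ _).trans (hK _ _ ?_)
      rw [add_sub_add_right_eq_sub]
      linarith [norm_nonneg (x - (swapOrthogonal L (x, y)).1)]
    · simp [hy]
  · have : x + a ∉ plate d L δ a := fun h => hx (by simpa using mem_plate_iff_sub_mem.1 h)
    simp [this]

/-- For functions that are essentially constant at scale `r`, passing to thinner plates does not
increase the maximal operator. -/
theorem maxOp_le_of_locally_constant (hδ : 0 < δ) (hδr : δ ≤ r)
    {g : Ed d → ℝ≥0∞} (hg : Measurable g) {K : ℝ≥0∞}
    (hK : ∀ x x', ‖x - x'‖ ≤ 4 * r → g x ≤ K * g x') :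
    maxOp d δ g L ≤ K * (ENNReal.ofReal (2 ^ d) * ENNReal.ofReal (3 ^ d)) * maxOp d r g L := by
  have hr := hδ.trans_le hδr
  refine maxOp_le_of_setLIntegral_le hδ fun a => ?_
  rcases le_total r (1 / 2) with hr2 | hr2
  · rw [← ENNReal.mul_le_mul_iff_right (volume_plate_ne_zero (L := L) hr 0) (volume_plate_ne_top 0)]
    refine (volume_mul_setLIntegral_le hδr hr2 hg hK a).trans
      ((mul_le_mul_right (setLIntegral_dilate_plate_le hr hg a) _).trans_eq ?_)
    ring
  · have h1 : ∀ x ∈ plate d L δ a, g x ≤ K * maxOp d r g L := by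
      intro x hx
      rw [← ENNReal.mul_le_mul_iff_right (volume_plate_ne_zero (L := L) hr a)
        (volume_plate_ne_top a), mul_comm, ← setLIntegral_const]
      have h2 : ∀ y ∈ plate d L r a, g x ≤ K * g y := fun y hy => hK _ _ <| by
        have := norm_sub_le (x - a) (y - a)
        rw [sub_sub_sub_cancel_right] at this
        linarith [norm_sub_lt_of_mem_plate hx, norm_sub_lt_of_mem_plate hy]
      refine (setLIntegral_mono (hg.const_mul K) h2).trans ?_
      rw [lintegral_const_mul _ hg, mul_left_comm, volume_plate]
      exact mul_le_mul_right (setLIntegral_plate_le hr g a) _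
    have h3 : (1 : ℝ≥0∞) ≤ ENNReal.ofReal (2 ^ d) * ENNReal.ofReal (3 ^ d) := by
      refine one_le_mul ?_ ?_ <;> exact ENNReal.one_le_ofReal.2 (one_le_pow₀ (by norm_num))
    calc ∫⁻ x in plate d L δ a, g x ≤ ∫⁻ _ in plate d L δ a, K * maxOp d r g L :=
          setLIntegral_mono measurable_const h1
      _ = volume (plate d L δ 0) * (K * 1 * maxOp d r g L) := by
          rw [setLIntegral_const, volume_plate, mul_one, mul_comm]
      _ ≤ _ := by gcongr

theorem maxOp_lintegral_translate_le (hr : 0 < r) {u w : Ed d → ℝ≥0∞} (hu : Measurable u)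
    (hw : Measurable w) :
    maxOp d r (fun x => ∫⁻ y, w y * u (x - r • y)) L ≤ (∫⁻ y, w y) * maxOp d r u L := by
  refine maxOp_le_of_setLIntegral_le hr fun a => ?_
  rw [lintegral_lintegral_swap (by fun_prop), mul_left_comm, ← lintegral_mul_const _ hw]
  refine lintegral_mono fun y => ?_
  rw [lintegral_const_mul _ (by fun_prop)]
  refine mul_le_mul_right (le_trans (le_of_eq ?_) (setLIntegral_plate_le hr u (a - r • y))) _
  rw [← lintegral_indicator isOpen_plate.measurableSet,
    ← lintegral_indicator isOpen_plate.measurableSet,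
    ← lintegral_sub_right_eq_self ((plate d L r (a - r • y)).indicator u) (r • y)]
  refine lintegral_congr fun x => ?_
  have : x ∈ plate d L r a ↔ x - r • y ∈ plate d L r (a - r • y) := by
    rw [mem_plate_iff_sub_mem, mem_plate_iff_sub_mem (a := a - r • y), sub_sub_sub_cancel_right]
  by_cases hx : x ∈ plate d L r a
  · rw [indicator_of_mem hx, indicator_of_mem (this.1 hx)]
  · rw [indicator_of_notMem hx, indicator_of_notMem (mt this.2 hx)]

theorem lintegral_translate_le_mul (hr : 0 < r) {u w : Ed d → ℝ≥0∞} (hu : Measurable u)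
    (hw : Measurable w) {K : ℝ≥0∞} (hK : ∀ y v, ‖v‖ ≤ 4 → w y ≤ K * w (y + v))
    {x x' : Ed d} (hx : ‖x - x'‖ ≤ 4 * r) :
    ∫⁻ y, w y * u (x - r • y) ≤ K * ∫⁻ y, w y * u (x' - r • y) := by
  have hv : ‖r⁻¹ • (x' - x)‖ ≤ 4 := by
    rw [norm_smul, norm_inv, Real.norm_of_nonneg hr.le, norm_sub_rev, inv_mul_le_iff₀ hr]
    linarith
  rw [← lintegral_add_right_eq_self (fun y => w y * u (x' - r • y)) (r⁻¹ • (x' - x)),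
    ← lintegral_const_mul _ (by fun_prop)]
  refine lintegral_mono fun y => ?_
  rw [smul_add, smul_inv_smul₀ hr.ne', show x' - (r • y + (x' - x)) = x - r • y by abel,
    ← mul_assoc]
  exact mul_le_mul_left (hK _ _ hv) _

end Plates

theorem one_add_norm_pow_inv_le {E : Type*} [SeminormedAddCommGroup E] (N : ℕ) {y v : E}
    (hv : ‖v‖ ≤ 4) :
    ENNReal.ofReal (((1 + ‖y‖) ^ N)⁻¹) ≤
      ENNReal.ofReal (5 ^ N) * ENNReal.ofReal (((1 + ‖y + v‖) ^ N)⁻¹) := by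
  rw [← ENNReal.ofReal_mul (by positivity)]
  refine ENNReal.ofReal_le_ofReal ?_
  rw [← div_eq_mul_inv, ← one_div, div_le_div_iff₀ (by positivity) (by positivity), one_mul,
    ← mul_pow]
  gcongr
  linarith [norm_add_le y v, norm_nonneg y]

open FourierTransform Real in
/-- for band-limited `f`, plate averages at any scale `δ` are controlled by
plate averages at scale `1/R`. -/
theorem stmt_13 (d k : ℕ) (hk : 1 ≤ k) (hkd : k < d) :
    ∃ C > (0:ℝ), ∀ R : ℝ, 0 < R → ∀ f : Ed d → ℂ, Integrable f →
      (Function.support (𝓕 f) ⊆ Metric.closedBall 0 R) →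
      ∀ (L : Submodule ℝ (Ed d)), Module.finrank ℝ L = k → ∀ δ : ℝ, 0 < δ →
        maxOp d δ (fun x => (‖f x‖₊ : ℝ≥0∞)) L
          ≤ ENNReal.ofReal C * maxOp d (1 / R) (fun x => (‖f x‖₊ : ℝ≥0∞)) L := by
  obtain ⟨φ, hφ⟩ := exists_schwartz_fourier_eq_one d
  obtain ⟨A, hA, hφA⟩ := φ.exists_enorm_le_one_add_norm_pow (d + 1)
  set w : Ed d → ℝ≥0∞ := fun y => ENNReal.ofReal (((1 + ‖y‖) ^ (d + 1))⁻¹)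
  have hw : Measurable w := by fun_prop
  have hwt : ∫⁻ y, w y ≠ ∞ := by
    have h := finite_integral_one_add_norm (E := Ed d) (μ := volume) (r := (d + 1 : ℕ)) (by simp)
    simp only [Real.rpow_neg (add_nonneg zero_le_one (norm_nonneg _)), Real.rpow_natCast] at h
    exact h.ne
  set D : ℝ≥0∞ := ENNReal.ofReal A * (ENNReal.ofReal (5 ^ (d + 1)) *
    (ENNReal.ofReal (2 ^ d) * ENNReal.ofReal (3 ^ d)) * ∫⁻ y, w y)
  have hD : D ≠ ∞ := by finiteness
  refine ⟨2 ^ d + D.toReal, by positivity, fun R hR f hf hs L _ δ hδ => ?_⟩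
  rw [ENNReal.ofReal_add (by positivity) ENNReal.toReal_nonneg, ENNReal.ofReal_toReal hD, add_mul,
    one_div]
  have hr : 0 < R⁻¹ := inv_pos.2 hR
  set u : Ed d → ℝ≥0∞ := fun x => ‖hf.1.mk f x‖ₑ
  have hu : Measurable u := hf.1.stronglyMeasurable_mk.measurable.enorm
  have hfu : (fun x => (‖f x‖₊ : ℝ≥0∞)) =ᵐ[volume] u :=
    hf.1.ae_eq_mk.mono fun x hx => congrArg (‖·‖ₑ) hx
  rw [maxOp_congr_ae hfu, maxOp_congr_ae hfu]
  rcases le_total R⁻¹ δ with hle | hle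
  · exact (maxOp_le_of_le hr hle hu).trans le_self_add
  refine le_add_left ?_
  set g : Ed d → ℝ≥0∞ := fun x => ∫⁻ y, w y * u (x - R⁻¹ • y)
  have hg : Measurable g := Measurable.lintegral_prod_right' (f := fun p : Ed d × Ed d =>
    w p.2 * u (p.1 - R⁻¹ • p.2)) (by fun_prop)
  have hf' : 𝓕 (hf.1.mk f) = 𝓕 f := by
    ext ξ
    simp only [Real.fourier_eq]
    exact integral_congr_ae (hf.1.ae_eq_mk.mono fun x hx => by simp only [hx])
  have hug : u ≤ᵐ[volume] fun x => ENNReal.ofReal A * g x := by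
    filter_upwards [ae_enorm_le_lintegral_of_fourier_support_subset φ.integrable hφ
      (hf.congr hf.1.ae_eq_mk) hR (hf' ▸ hs)] with x hx
    rw [← lintegral_const_mul _ (by fun_prop)]
    refine hx.trans (lintegral_mono fun y => ?_)
    rw [← mul_assoc]
    exact mul_le_mul_left (hφA y) _
  calc maxOp d δ u L ≤ ENNReal.ofReal A * maxOp d δ g L :=
        (maxOp_mono_ae hug).trans_eq (maxOp_const_mul hg _)
    _ ≤ ENNReal.ofReal A * (ENNReal.ofReal (5 ^ (d + 1)) *
          (ENNReal.ofReal (2 ^ d) * ENNReal.ofReal (3 ^ d)) *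
          ((∫⁻ y, w y) * maxOp d R⁻¹ u L)) := by
        refine mul_le_mul_right ((maxOp_le_of_locally_constant hδ hle hg fun x x' hx =>
          lintegral_translate_le_mul hr hu hw (fun y v hv => one_add_norm_pow_inv_le _ hv)
            hx).trans ?_) _
        exact mul_le_mul_right (maxOp_lintegral_translate_le hr hu hw) _
    _ = D * maxOp d R⁻¹ u L := by ring
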